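/- arXiv:2601.02282 — 3 statements merged into one kernel-verified Lean document; each statement's English description precedes it below -/
import Mathlib

section
/- Let n ≥ 2 and let Φ : M_n(ℂ) → M_n(ℂ) be a ℂ-linear map that is U(n)-equivariant, i.e. Φ(U X U*) = U Φ(X) U* for every unitary matrix U ∈ U(n) and every X ∈ M_n(ℂ). Then there exist complex numbers σ and λ such that Φ(X) = ((σ − λ)/n)·tr(X)·I_n + λ·X for all X ∈ M_n(ℂ). -/
open Matrix

lemma exists_perm_map_pair {ι : Type*} [DecidableEq ι] {a b k i : ι} (hab : a ≠ b)
    (hki : k ≠ i) :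
    ∃ σ : Equiv.Perm ι, σ a = k ∧ σ b = i := by
  refine ⟨Equiv.swap (Equiv.swap a k b) i * Equiv.swap a k, ?_, by simp⟩
  have : k ≠ Equiv.swap a k b := fun e => hab <| (Equiv.swap a k).injective <| by simpa using e
  simp [Equiv.swap_apply_of_ne_of_ne this hki]

section UnitaryEquivariant

variable {ι : Type*} [Fintype ι] [DecidableEq ι]

/-- Equivariance of a linear map of matrices under conjugation by unitary matrices. -/
def IsUnitaryEquivariant (Φ : Matrix ι ι ℂ →ₗ[ℂ] Matrix ι ι ℂ) : Prop :=
  ∀ U : Matrix ι ι ℂ, U ∈ Matrix.unitaryGroup ι ℂ →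
    ∀ X : Matrix ι ι ℂ, Φ (U * X * Uᴴ) = U * Φ X * Uᴴ

variable {Φ Ψ : Matrix ι ι ℂ →ₗ[ℂ] Matrix ι ι ℂ}

lemma IsUnitaryEquivariant.map_submatrix (h : IsUnitaryEquivariant Φ) (σ : Equiv.Perm ι)
    (X : Matrix ι ι ℂ) : Φ (X.submatrix σ σ) = (Φ X).submatrix σ σ := by
  have key : ∀ Y : Matrix ι ι ℂ,
      (1 : Matrix ι ι ℂ).submatrix σ id * Y * ((1 : Matrix ι ι ℂ).submatrix σ id)ᴴ
        = Y.submatrix σ σ := by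
    intro Y
    ext i j
    simp [Matrix.mul_apply, Matrix.one_apply]
  have hU : (1 : Matrix ι ι ℂ).submatrix σ id ∈ Matrix.unitaryGroup ι ℂ := by
    rw [Matrix.mem_unitaryGroup_iff, Matrix.star_eq_conjTranspose]
    simpa using key 1
  rw [← key, h _ hU, key]

lemma IsUnitaryEquivariant.map_diagonal_apply_of_ne (h : IsUnitaryEquivariant Φ) (d : ι → ℂ)
    {i j : ι} (hij : i ≠ j) : Φ (diagonal d) i j = 0 := by
  let s : ι → ℂ := fun m => if m = j then -1 else 1
  have hs : (diagonal s)ᴴ = diagonal s := by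
    rw [diagonal_conjTranspose]
    congr 1
    ext m
    simp only [s, Pi.star_apply]
    split_ifs <;> simp
  have hsq : ∀ m, s m * s m = 1 := by
    intro m
    simp only [s]
    split_ifs <;> simp
  have hU : diagonal s ∈ Matrix.unitaryGroup ι ℂ := by
    rw [Matrix.mem_unitaryGroup_iff, Matrix.star_eq_conjTranspose, hs, diagonal_mul_diagonal]
    simp [hsq]
  have hd : diagonal s * diagonal d * diagonal s = diagonal d := by
    rw [diagonal_mul_diagonal, diagonal_mul_diagonal]
    congr 1
    ext m
    rw [mul_right_comm, hsq, one_mul]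
  have e := congrFun (congrFun (h _ hU (diagonal d)) i) j
  rw [hs, hd, mul_diagonal, diagonal_mul] at e
  simp only [s, if_neg hij, if_true] at e
  linear_combination e / 2

lemma IsUnitaryEquivariant.map_single_apply_perm (h : IsUnitaryEquivariant Φ) (σ : Equiv.Perm ι)
    (k i : ι) : Φ (single (σ k) (σ k) 1) (σ i) (σ i) = Φ (single k k 1) i i := by
  have e : (single (σ k) (σ k) (1 : ℂ)).submatrix σ σ = single k k 1 := by
    ext a b
    simp [single_apply]
  rw [← e, h.map_submatrix, submatrix_apply]

/-- Unitarily equivariant linear maps are determined by their values on diagonal matrix units. -/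
lemma IsUnitaryEquivariant.ext_single (hΦ : IsUnitaryEquivariant Φ) (hΨ : IsUnitaryEquivariant Ψ)
    (h : ∀ k, Φ (single k k 1) = Ψ (single k k 1)) : Φ = Ψ := by
  have hdiag : ∀ d : ι → ℂ, Φ (diagonal d) = Ψ (diagonal d) := by
    intro d
    have hd : diagonal d = ∑ k, d k • single k k (1 : ℂ) := by
      ext i j
      simp [Matrix.sum_apply, single_apply, diagonal_apply, ite_and]
    simp only [hd, map_sum, map_smul, h]
  have hherm : ∀ X : Matrix ι ι ℂ, X.IsHermitian → Φ X = Ψ X := by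
    intro X hX
    have e := hX.spectral_theorem
    rw [Unitary.conjStarAlgAut_apply, Matrix.star_eq_conjTranspose] at e
    rw [e, hΦ _ hX.eigenvectorUnitary.2, hΨ _ hX.eigenvectorUnitary.2, hdiag]
  ext1 X
  rw [← realPart_add_I_smul_imaginaryPart X, map_add, map_add, map_smul, map_smul,
    hherm _ (realPart X).2, hherm _ (imaginaryPart X).2]

lemma isUnitaryEquivariant_trace_smul_one_add_smul (b l : ℂ) :
    IsUnitaryEquivariant (ι := ι)
      (b • (traceLinearMap ι ℂ ℂ).smulRight (1 : Matrix ι ι ℂ) + l • LinearMap.id) := by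
  intro U hU X
  have h₁ : U * Uᴴ = 1 := Matrix.mem_unitaryGroup_iff.mp hU
  have h₂ : Uᴴ * U = 1 := Matrix.mem_unitaryGroup_iff'.mp hU
  have ht : (U * X * Uᴴ).trace = X.trace := by
    rw [trace_mul_cycle, h₂, one_mul]
  simp [ht, mul_add, add_mul, h₁]

theorem IsUnitaryEquivariant.exists_eq_trace_smul_one_add_smul [Nontrivial ι]
    (h : IsUnitaryEquivariant Φ) :
    ∃ b l : ℂ, ∀ X, Φ X = (b * X.trace) • (1 : Matrix ι ι ℂ) + l • X := by
  obtain ⟨p, q, hpq⟩ := exists_pair_ne ι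
  set a := Φ (single p p 1) p p with ha
  set b := Φ (single p p 1) q q with hb
  have hΦ : Φ = b • (traceLinearMap ι ℂ ℂ).smulRight (1 : Matrix ι ι ℂ)
      + (a - b) • LinearMap.id := by
    refine h.ext_single (isUnitaryEquivariant_trace_smul_one_add_smul _ _) fun k => ?_
    ext i j
    rcases eq_or_ne i j with rfl | hij
    · rcases eq_or_ne k i with rfl | hki
      · have := h.map_single_apply_perm (Equiv.swap p k) p p
        rw [Equiv.swap_apply_left] at this
        simp [this, ha]
      · obtain ⟨σ, rfl, rfl⟩ := exists_perm_map_pair hpq hki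
        simp [h.map_single_apply_perm, hb, hpq]
    · rw [← diagonal_single, h.map_diagonal_apply_of_ne _ hij]
      simp [hij]
  refine ⟨b, a - b, fun X => ?_⟩
  conv_lhs => rw [hΦ]
  simp [mul_smul]

end UnitaryEquivariant

/-- Every `ℂ`-linear `U(n)`-equivariant map `Φ : M_n(ℂ) → M_n(ℂ)` (`n ≥ 2`)
has the form `Φ(X) = ((σ - λ)/n)·tr(X)·I_n + λ·X` for some `σ, λ ∈ ℂ`. -/
theorem unitary_equivariant_structure (n : ℕ) (hn : 2 ≤ n)
    (Φ : Matrix (Fin n) (Fin n) ℂ →ₗ[ℂ] Matrix (Fin n) (Fin n) ℂ)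
    (hequiv : ∀ U : Matrix (Fin n) (Fin n) ℂ, U ∈ Matrix.unitaryGroup (Fin n) ℂ →
      ∀ X : Matrix (Fin n) (Fin n) ℂ, Φ (U * X * Uᴴ) = U * Φ X * Uᴴ) :
    ∃ σ l : ℂ, ∀ X : Matrix (Fin n) (Fin n) ℂ,
      Φ X = ((σ - l) / n * X.trace) • (1 : Matrix (Fin n) (Fin n) ℂ) + l • X := by
  have : Nontrivial (Fin n) := Fin.nontrivial_iff_two_le.mpr hn
  have hn₀ : (n : ℂ) ≠ 0 := Nat.cast_ne_zero.mpr (by omega)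
  obtain ⟨b, l, h⟩ := IsUnitaryEquivariant.exists_eq_trace_smul_one_add_smul hequiv
  refine ⟨n * b + l, l, fun X => ?_⟩
  rw [h, add_sub_cancel_right, mul_div_cancel_left₀ _ hn₀]
end

section
/- Let n ≥ 2 and λ ∈ ℂ, and define the unital map Φ_λ : M_n(ℂ) → M_n(ℂ) by Φ_λ(X) = ((1 − λ)/n)·tr(X)·I_n + λ·X. Then Φ_λ satisfies the Schwarz (Kadison) inequality, i.e. Φ_λ(X*X) − Φ_λ(X)*Φ_λ(X) is positive semidefinite for every X ∈ M_n(ℂ), if and only if λ is real and −1/n ≤ λ ≤ 1. -/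
open Matrix
open scoped ComplexOrder

/-- A positive semidefinite matrix is dominated by its trace times the identity. -/
theorem Matrix.PosSemidef.trace_smul_one_sub {m : Type*} [Fintype m] [DecidableEq m]
    {A : Matrix m m ℂ} (hA : A.PosSemidef) :
    (A.trace • (1 : Matrix m m ℂ) - A).PosSemidef := by
  have hs := hA.isHermitian.spectral_theorem
  set U := hA.isHermitian.eigenvectorUnitary
  have hUU : (U : Matrix m m ℂ) * (U : Matrix m m ℂ)ᴴ = 1 := by
    rw [← Matrix.star_eq_conjTranspose]; exact Unitary.coe_mul_star_self U
  have key : A.trace • (1 : Matrix m m ℂ) - A =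
      (U : Matrix m m ℂ) * diagonal (fun i => A.trace - (hA.isHermitian.eigenvalues i : ℂ)) *
        (U : Matrix m m ℂ)ᴴ := by
    rw [← diagonal_sub, mul_sub, sub_mul, ← smul_one_eq_diagonal]
    refine congrArg₂ _ ?_ hs
    simp [hUU]
  rw [key]
  refine PosSemidef.mul_mul_conjTranspose_same (posSemidef_diagonal_iff.2 fun i => ?_) _
  rw [hA.isHermitian.trace_eq_sum_eigenvalues, sub_nonneg]
  exact Finset.single_le_sum (f := fun j => (hA.isHermitian.eigenvalues j : ℂ))
    (fun j _ => Complex.zero_le_real.2 (hA.eigenvalues_nonneg j)) (Finset.mem_univ i)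

/-- For `n ≥ 2` and `λ ∈ ℂ`, the unital map
`Φ_λ(X) = ((1 - λ)/n)·tr(X)·I_n + λ·X` satisfies the Schwarz (Kadison) inequality,
i.e. `Φ_λ(XᴴX) - Φ_λ(X)ᴴ Φ_λ(X)` is positive semidefinite for every `X`,
if and only if `λ` is real and `-1/n ≤ λ ≤ 1`. -/
theorem unitary_equivariant_schwarz_iff (n : ℕ) (hn : 2 ≤ n) (l : ℂ)
    (Φ : Matrix (Fin n) (Fin n) ℂ → Matrix (Fin n) (Fin n) ℂ)
    (hΦ : ∀ X : Matrix (Fin n) (Fin n) ℂ,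
      Φ X = ((1 - l) / n * X.trace) • (1 : Matrix (Fin n) (Fin n) ℂ) + l • X) :
    (∀ X : Matrix (Fin n) (Fin n) ℂ, (Φ (Xᴴ * X) - (Φ X)ᴴ * Φ X).PosSemidef) ↔
      (l.im = 0 ∧ -(1 / (n : ℝ)) ≤ l.re ∧ l.re ≤ 1) := by
  have hn0 : (0 : ℝ) < n := by positivity
  have hnC : (n : ℂ) ≠ 0 := by exact_mod_cast hn0.ne'
  constructor
  · intro h
    let i : Fin n := ⟨0, by omega⟩
    let j : Fin n := ⟨1, by omega⟩
    have hij : i ≠ j := by simp [i, j]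
    have hP := h (single i j 1)
    have h0 := hP.diag_nonneg (i := i)
    have h1 := hP.diag_nonneg (i := j)
    simp [hΦ, hij, hij.symm] at h0 h1
    have him : l.im = 0 := by
      have := (Complex.le_def.1 h0).2
      simpa [Complex.div_natCast_im, eq_comm, show n ≠ 0 by omega] using this
    obtain ⟨r, rfl⟩ : ∃ r : ℝ, l = r := ⟨l.re, by apply Complex.ext <;> simp [him]⟩
    have h0' : 0 ≤ (1 - r) / n := by
      rw [← Complex.zero_le_real]; push_cast; exact h0
    have h1' : 0 ≤ (1 - r) / n + r - r * r := by
      rw [← Complex.zero_le_real]; push_cast; simpa using h1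
    have hr : r ≤ 1 := by
      have := (le_div_iff₀ hn0).1 h0'
      linarith
    refine ⟨him, ?_, hr⟩
    simp only [Complex.ofReal_re]
    rcases hr.eq_or_lt with rfl | hr
    · have : 0 < 1 / (n : ℝ) := by positivity
      linarith
    · have : 0 ≤ (1 - r) * (1 / n + r) := by
        convert h1' using 1; ring
      have := nonneg_of_mul_nonneg_right this (by linarith)
      linarith
  · rintro ⟨him, hlo, hhi⟩ X
    obtain ⟨r, rfl⟩ : ∃ r : ℝ, l = r := ⟨l.re, by apply Complex.ext <;> simp [him]⟩
    simp only [Complex.ofReal_re] at hlo hhi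
    obtain ⟨a, Y, hY, rfl⟩ : ∃ (a : ℂ) (Y : Matrix (Fin n) (Fin n) ℂ),
        Y.trace = 0 ∧ X = a • (1 : Matrix (Fin n) (Fin n) ℂ) + Y :=
      ⟨X.trace / n, X - (X.trace / n) • (1 : Matrix (Fin n) (Fin n) ℂ), by
        simp [trace_sub, trace_smul, hnC], by simp⟩
    have hY' : Yᴴ.trace = 0 := by simp [trace_conjTranspose, hY]
    have hYY := posSemidef_conjTranspose_mul_self Y
    have key : Φ ((a • (1 : Matrix (Fin n) (Fin n) ℂ) + Y)ᴴ * (a • (1 : Matrix (Fin n) (Fin n) ℂ) + Y))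
          - (Φ (a • (1 : Matrix (Fin n) (Fin n) ℂ) + Y))ᴴ * Φ (a • (1 : Matrix (Fin n) (Fin n) ℂ) + Y) =
        (((1 - r) / n : ℝ) : ℂ) • (((Yᴴ * Y).trace • (1 : Matrix (Fin n) (Fin n) ℂ) - Yᴴ * Y) +
          ((1 + n * r : ℝ) : ℂ) • (Yᴴ * Y)) := by
      have e : Φ (a • (1 : Matrix (Fin n) (Fin n) ℂ) + Y) =
          a • (1 : Matrix (Fin n) (Fin n) ℂ) + (r : ℂ) • Y := by
        rw [hΦ, trace_add, hY, trace_smul, trace_one, Fintype.card_fin]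
        ext p q
        simp only [Matrix.add_apply, Matrix.smul_apply, smul_eq_mul]
        field_simp
        ring
      have e2 : (a • (1 : Matrix (Fin n) (Fin n) ℂ) + Y)ᴴ * (a • (1 : Matrix (Fin n) (Fin n) ℂ) + Y)
          = (star a * a) • (1 : Matrix (Fin n) (Fin n) ℂ) + star a • Y + a • Yᴴ + Yᴴ * Y := by
        simp [add_mul, mul_add, smul_smul, mul_comm]
        abel
      rw [e, e2, hΦ]
      simp only [conjTranspose_add, conjTranspose_smul, conjTranspose_one, trace_add, trace_smul,
        hY, hY', trace_one, Fintype.card_fin, add_mul, mul_add, Matrix.smul_mul, Matrix.mul_smul,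
        one_mul, mul_one]
      ext p q
      simp
      field_simp
      ring
    rw [key]
    have hlo' : 0 ≤ 1 + n * r := by
      have := mul_le_mul_of_nonneg_left hlo hn0.le
      field_simp at this
      linarith
    exact (hYY.trace_smul_one_sub.add (hYY.smul (Complex.zero_le_real.2 hlo'))).smul
      (Complex.zero_le_real.2 (div_nonneg (by linarith) hn0.le))
end

section
/- Let n₁, n₂ ≥ 2 and let Φ be a ℂ-linear map on the algebra of complex matrices indexed by {1,…,n₁}×{1,…,n₂} (identified with M_{n₁}(ℂ) ⊗ M_{n₂}(ℂ)) such that Φ((U⊗V) X (U⊗V)*) = (U⊗V) Φ(X) (U⊗V)* for every unitary U ∈ U(n₁), every unitary V ∈ U(n₂), and every X, where U⊗V denotes the Kronecker product. Then there exist complex numbers λ₀₀, λ₀₁, λ₁₀, λ₁₁ such that for all A ∈ M_{n₁}(ℂ) and B ∈ M_{n₂}(ℂ): Φ(A⊗B) = λ₀₀·(tr A · tr B/(n₁n₂))·I_{n₁}⊗I_{n₂} + λ₀₁·(tr A/n₁)·(I_{n₁}⊗B⊥) + λ₁₀·(tr B/n₂)·(A⊥⊗I_{n₂}) + λ₁₁·(A⊥⊗B⊥),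 where A⊥ = A − (tr A/n₁)·I_{n₁} and B⊥ = B − (tr B/n₂)·I_{n₂}. -/
open Matrix
open scoped Kronecker

namespace Matrix

variable {m n : Type*} [Fintype m] [DecidableEq m] [Fintype n] [DecidableEq n]

/-- A linear map on square matrices that commutes with conjugation by every unitary matrix. -/
def IsUnitaryEquivariant (Ψ : Matrix n n ℂ →ₗ[ℂ] Matrix n n ℂ) : Prop :=
  ∀ U ∈ unitaryGroup n ℂ, ∀ X, Ψ (U * X * Uᴴ) = U * Ψ X * Uᴴ

namespace IsUnitaryEquivariant

variable {Ψ : Matrix n n ℂ →ₗ[ℂ] Matrix n n ℂ}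

theorem apply_single_perm (hΨ : IsUnitaryEquivariant Ψ) (σ : Equiv.Perm n) (i j k l : n) :
    Ψ (single (σ i) (σ j) 1) (σ k) (σ l) = Ψ (single i j 1) k l := by
  have hconj (X : Matrix n n ℂ) :
      σ.permMatrix ℂ * X * (σ.permMatrix ℂ)ᴴ = X.submatrix σ σ := by
    rw [conjTranspose_permMatrix, Equiv.Perm.permMatrix, Equiv.Perm.permMatrix,
      PEquiv.toMatrix_toPEquiv_mul, PEquiv.mul_toMatrix_toPEquiv]
    rfl
  have hσ : σ.permMatrix ℂ ∈ unitaryGroup n ℂ := by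
    rw [mem_unitaryGroup_iff, star_eq_conjTranspose, conjTranspose_permMatrix,
      ← permMatrix_mul, inv_mul_cancel, permMatrix_one]
  have h := hΨ _ hσ (single (σ i) (σ j) 1)
  rw [hconj, hconj, submatrix_single_equiv] at h
  simpa using (congr_fun₂ h k l).symm

theorem apply_single_eq (hΨ : IsUnitaryEquivariant Ψ) {i j k l : n}
    (hij : i ≠ j) (hkl : k ≠ l) :
    Ψ (single i j 1) i j = Ψ (single k l 1) k l ∧
      Ψ (single i i 1) i i = Ψ (single k k 1) k k ∧
      Ψ (single i i 1) j j = Ψ (single k k 1) l l := by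
  obtain ⟨σ, rfl, rfl⟩ : ∃ σ : Equiv.Perm n, σ i = k ∧ σ j = l := by
    have hk : Equiv.swap i k j ≠ k := fun h ↦
      hij ((Equiv.swap i k).injective (by rw [h, Equiv.swap_apply_left]))
    refine ⟨Equiv.swap (Equiv.swap i k j) l * Equiv.swap i k, ?_, ?_⟩
    · simp [Equiv.swap_apply_of_ne_of_ne hk.symm hkl]
    · simp
  exact ⟨(hΨ.apply_single_perm σ ..).symm, (hΨ.apply_single_perm σ ..).symm,
    (hΨ.apply_single_perm σ ..).symm⟩

theorem apply_single_phase (hΨ : IsUnitaryEquivariant Ψ) {d : n → ℂ}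
    (hd : ∀ i, d i * star (d i) = 1) (i j k l : n) :
    d i * star (d j) * Ψ (single i j 1) k l = d k * star (d l) * Ψ (single i j 1) k l := by
  have hU : diagonal d ∈ unitaryGroup n ℂ := by
    rw [mem_unitaryGroup_iff, star_eq_conjTranspose, diagonal_conjTranspose,
      diagonal_mul_diagonal, ← diagonal_one]
    exact congr_arg diagonal (funext hd)
  have hsingle : diagonal d * single i j 1 * (diagonal d)ᴴ =
      (d i * star (d j)) • single i j (1 : ℂ) := by
    ext p q
    simp only [diagonal_conjTranspose, mul_diagonal, diagonal_mul, smul_apply, single_apply]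
    split_ifs with h
    · simp [h.1, h.2]
    · simp
  have h := congr_fun₂ (hΨ _ hU (single i j 1)) k l
  rw [hsingle, map_smul, diagonal_conjTranspose, mul_diagonal, diagonal_mul] at h
  simp only [smul_apply, smul_eq_mul, Pi.star_apply] at h
  rw [h]; ring

theorem apply_single_phase_one (hΨ : IsUnitaryEquivariant Ψ) (a i j k l : n) :
    (if i = a then Complex.I else 1) * (if j = a then -Complex.I else 1) *
        Ψ (single i j 1) k l =
      (if k = a then Complex.I else 1) * (if l = a then -Complex.I else 1) *
        Ψ (single i j 1) k l := by
  have h := hΨ.apply_single_phase (d := fun i ↦ if i = a then Complex.I else 1)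
    (fun i ↦ by split_ifs <;> simp) i j k l
  simpa only [apply_ite star, star_one, Complex.star_def, Complex.conj_I] using h

theorem apply_single_diag_eq_zero (hΨ : IsUnitaryEquivariant Ψ) (i : n) {k l : n}
    (hkl : k ≠ l) : Ψ (single i i 1) k l = 0 := by
  have h := hΨ.apply_single_phase_one k i i k l
  rw [if_pos rfl, if_neg hkl.symm] at h
  split_ifs at h <;> simp at h <;> grind [Complex.I_mul_I]

theorem apply_single_offDiag_eq_zero (hΨ : IsUnitaryEquivariant Ψ) {i j k l : n}
    (hij : i ≠ j) (hkl : ¬(i = k ∧ j = l)) : Ψ (single i j 1) k l = 0 := by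
  have hi := hΨ.apply_single_phase_one i i j k l
  have hj := hΨ.apply_single_phase_one j i j k l
  have hI : Complex.I * Complex.I = -1 := Complex.I_mul_I
  by_contra h0
  rw [mul_left_inj' h0] at hi hj
  have h1 : Complex.I ≠ 1 := by simp [Complex.ext_iff]
  have h2 : Complex.I ≠ -Complex.I := by simp [Complex.ext_iff]; norm_num
  have h3 : -Complex.I ≠ 1 := by simp [Complex.ext_iff]
  grind

theorem apply_commutator (hΨ : IsUnitaryEquivariant Ψ) {S : Matrix n n ℂ}
    (hS : Sᴴ = S) (hSS : S * S = 1) (X : Matrix n n ℂ) :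
    Ψ (X * S - S * X) = Ψ X * S - S * Ψ X := by
  have hSU : S ∈ unitaryGroup n ℂ := by
    rw [mem_unitaryGroup_iff, star_eq_conjTranspose, hS, hSS]
  set a : ℂ := (1 + Complex.I) / 2 with ha
  set b : ℂ := (1 - Complex.I) / 2 with hb
  have hI : Complex.I ^ 2 = -1 := Complex.I_sq
  have hstar : (a • (1 : Matrix n n ℂ) + b • S)ᴴ = b • 1 + a • S := by
    simp [conjTranspose_add, conjTranspose_smul, hS, ha, hb, sub_eq_add_neg]
  have hab : a * b = 1 / 2 := by rw [ha, hb]; linear_combination -(1 / 4) * hI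
  have haa : a * a = Complex.I / 2 := by rw [ha]; linear_combination (1 / 4) * hI
  have hbb : b * b = -(Complex.I / 2) := by rw [hb]; linear_combination (1 / 4) * hI
  have hconj (Y : Matrix n n ℂ) :
      (a • (1 : Matrix n n ℂ) + b • S) * Y * (b • 1 + a • S) =
        (1 / 2 : ℂ) • (Y + S * Y * S) + (Complex.I / 2) • (Y * S - S * Y) := by
    simp only [add_mul, mul_add, smul_mul_assoc, mul_smul_comm, one_mul, mul_one, smul_add,
      smul_smul, mul_comm b a, hab, haa, hbb, smul_sub, neg_smul]
    abel
  have hU : a • (1 : Matrix n n ℂ) + b • S ∈ unitaryGroup n ℂ := by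
    have h := hconj 1
    simp only [mul_one, one_mul, hSS, sub_self, smul_zero, add_zero] at h
    rw [mem_unitaryGroup_iff, star_eq_conjTranspose, hstar, h, ← two_smul ℂ, smul_smul]
    norm_num
  have h := hΨ _ hU X
  have hS' := hΨ _ hSU X
  rw [hS] at hS'
  rw [hstar, hconj, hconj, map_add, map_smul, map_smul, map_add, hS'] at h
  exact smul_right_injective _ (by simp) (add_left_cancel h)

theorem apply_single_diag_sub (hΨ : IsUnitaryEquivariant Ψ) {i j : n} (hij : i ≠ j) :
    Ψ (single i i 1) i i - Ψ (single i i 1) j j = Ψ (single i j 1) i j := by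
  set S := (Equiv.swap i j).permMatrix ℂ with hS
  have hSH : Sᴴ = S := by rw [hS, conjTranspose_permMatrix, Equiv.swap_inv]
  have hSS : S * S = 1 := by rw [hS, ← permMatrix_mul, Equiv.swap_mul_self, permMatrix_one]
  have hmulS (Y : Matrix n n ℂ) (k l : n) : (Y * S) k l = Y k (Equiv.swap i j l) := by
    rw [hS, Equiv.Perm.permMatrix, PEquiv.mul_toMatrix_toPEquiv]; rfl
  have hSmul (Y : Matrix n n ℂ) (k l : n) : (S * Y) k l = Y (Equiv.swap i j k) l := by
    rw [hS, Equiv.Perm.permMatrix, PEquiv.toMatrix_toPEquiv_mul]; rfl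
  have h1 : single i i (1 : ℂ) * S = single i j 1 := by
    ext k l
    simp only [hmulS, single_apply, Equiv.swap_apply_def]
    grind
  have h2 : S * single i i (1 : ℂ) = single j i 1 := by
    ext k l
    simp only [hSmul, single_apply, Equiv.swap_apply_def]
    grind
  have h := congr_fun₂ (hΨ.apply_commutator hSH hSS (single i i 1)) i j
  rw [h1, h2, map_sub, sub_apply, sub_apply, hmulS, hSmul, Equiv.swap_apply_left,
    Equiv.swap_apply_right, hΨ.apply_single_offDiag_eq_zero hij.symm (by tauto), sub_zero] at h
  exact h.symm

/-- Unitarily equivariant maps are combinations of `X ↦ tr X • 1` and the identity. -/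
theorem eq_trace_smul_one_add_smul (hΨ : IsUnitaryEquivariant Ψ) {i j : n} (hij : i ≠ j)
    (X : Matrix n n ℂ) :
    Ψ X = (Ψ (single i i 1) j j * X.trace) • (1 : Matrix n n ℂ) +
      Ψ (single i j 1) i j • X := by
  suffices Ψ = Ψ (single i i 1) j j • (traceLinearMap n ℂ ℂ).smulRight (1 : Matrix n n ℂ) +
      Ψ (single i j 1) i j • LinearMap.id by
    simpa [smul_smul] using LinearMap.congr_fun this X
  refine ext_linearMap ℂ fun p q ↦ LinearMap.ext_ring <| Matrix.ext fun k l ↦ ?_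
  simp only [LinearMap.comp_apply, singleLinearMap_apply, LinearMap.add_apply,
    LinearMap.smul_apply, LinearMap.smulRight_apply, traceLinearMap_apply, LinearMap.id_apply,
    add_apply, smul_apply, smul_eq_mul]
  rcases eq_or_ne p q with rfl | hpq
  · rw [trace_single_eq_same, one_mul]
    rcases eq_or_ne k l with rfl | hkl
    · rw [one_apply_eq, mul_one]
      rcases eq_or_ne p k with rfl | hpk
      · obtain ⟨r, hr⟩ : ∃ r, p ≠ r := by
          by_contra! h
          exact hij ((h i).symm.trans (h j))
        obtain ⟨-, h, -⟩ := hΨ.apply_single_eq hr hij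
        rw [single_apply_same, h, ← hΨ.apply_single_diag_sub hij]
        ring
      · rw [(hΨ.apply_single_eq hpk hij).2.2, single_apply_of_ne _ _ _ _ _ (by tauto)]
        simp
    · rw [hΨ.apply_single_diag_eq_zero p hkl, one_apply_ne hkl,
        single_apply_of_ne _ _ _ _ _ (by rintro ⟨rfl, rfl⟩; exact hkl rfl)]
      simp
  · rw [trace_single_eq_of_ne _ _ _ hpq]
    by_cases h : p = k ∧ q = l
    · obtain ⟨rfl, rfl⟩ := h
      simp [(hΨ.apply_single_eq hpq hij).1]
    · rw [hΨ.apply_single_offDiag_eq_zero hpq h, single_apply_of_ne _ _ _ _ _ h]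
      simp

end IsUnitaryEquivariant

/-- `Φ` commutes with conjugation by every Kronecker product of unitary matrices. -/
def IsProductUnitaryEquivariant
    (Φ : Matrix (m × n) (m × n) ℂ →ₗ[ℂ] Matrix (m × n) (m × n) ℂ) : Prop :=
  ∀ U ∈ unitaryGroup m ℂ, ∀ V ∈ unitaryGroup n ℂ, ∀ X,
    Φ ((U ⊗ₖ V) * X * (U ⊗ₖ V)ᴴ) = (U ⊗ₖ V) * Φ X * (U ⊗ₖ V)ᴴ


/-- The map `A ↦ Φ (A ⊗ B)` followed by extraction of the `(k, l)` entry in the second factor. -/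
def leftSlice (Φ : Matrix (m × n) (m × n) ℂ →ₗ[ℂ] Matrix (m × n) (m × n) ℂ)
    (B : Matrix n n ℂ) (k l : n) : Matrix m m ℂ →ₗ[ℂ] Matrix m m ℂ where
  toFun A := (Φ (A ⊗ₖ B)).submatrix (·, k) (·, l)
  map_add' A A' := by simp [add_kronecker, submatrix_add]
  map_smul' c A := by simp [smul_kronecker, submatrix_smul]

/-- The map `B ↦ Φ (A ⊗ B)` followed by extraction of the `(i, j)` entry in the first factor. -/
def rightSlice (Φ : Matrix (m × n) (m × n) ℂ →ₗ[ℂ] Matrix (m × n) (m × n) ℂ)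
    (A : Matrix m m ℂ) (i j : m) : Matrix n n ℂ →ₗ[ℂ] Matrix n n ℂ where
  toFun B := (Φ (A ⊗ₖ B)).submatrix (i, ·) (j, ·)
  map_add' B B' := by simp [kronecker_add, submatrix_add]
  map_smul' c B := by simp [kronecker_smul, submatrix_smul]

theorem IsProductUnitaryEquivariant.leftSlice
    {Φ : Matrix (m × n) (m × n) ℂ →ₗ[ℂ] Matrix (m × n) (m × n) ℂ}
    (hΦ : IsProductUnitaryEquivariant Φ) (B : Matrix n n ℂ) (k l : n) :
    IsUnitaryEquivariant (leftSlice Φ B k l) := by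
  intro U hU A
  have h := hΦ U hU 1 (one_mem _) (A ⊗ₖ B)
  rw [conjTranspose_kronecker, ← mul_kronecker_mul, ← mul_kronecker_mul, conjTranspose_one,
    one_mul, mul_one] at h
  ext p q
  simp [Matrix.leftSlice, h, mul_apply, Fintype.sum_prod_type, one_apply]

theorem IsProductUnitaryEquivariant.rightSlice
    {Φ : Matrix (m × n) (m × n) ℂ →ₗ[ℂ] Matrix (m × n) (m × n) ℂ}
    (hΦ : IsProductUnitaryEquivariant Φ) (A : Matrix m m ℂ) (i j : m) :
    IsUnitaryEquivariant (rightSlice Φ A i j) := by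
  intro V hV B
  have h := hΦ 1 (one_mem _) V hV (A ⊗ₖ B)
  rw [conjTranspose_kronecker, ← mul_kronecker_mul, ← mul_kronecker_mul, conjTranspose_one,
    one_mul, mul_one] at h
  ext p q
  simp [Matrix.rightSlice, h, mul_apply, Fintype.sum_prod_type, one_apply]

theorem IsProductUnitaryEquivariant.exists_apply_kronecker
    {Φ : Matrix (m × n) (m × n) ℂ →ₗ[ℂ] Matrix (m × n) (m × n) ℂ}
    (hΦ : IsProductUnitaryEquivariant Φ) [Nontrivial m] [Nontrivial n] :
    ∃ a b c d : ℂ, ∀ (A : Matrix m m ℂ) (B : Matrix n n ℂ),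
      Φ (A ⊗ₖ B) = (a * A.trace * B.trace) • (1 : Matrix (m × n) (m × n) ℂ) +
        (b * A.trace) • ((1 : Matrix m m ℂ) ⊗ₖ B) +
        (c * B.trace) • (A ⊗ₖ (1 : Matrix n n ℂ)) + d • (A ⊗ₖ B) := by
  obtain ⟨i, j, hij⟩ := exists_pair_ne m
  obtain ⟨k, l, hkl⟩ := exists_pair_ne n
  set P := Matrix.rightSlice Φ (single i i 1) j j
  set Q := Matrix.rightSlice Φ (single i j 1) i j
  refine ⟨P (single k k 1) l l, P (single k l 1) k l, Q (single k k 1) l l,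
    Q (single k l 1) k l, fun A B ↦ ?_⟩
  ext ⟨p, r⟩ ⟨q, s⟩
  have h : Φ (A ⊗ₖ B) (p, r) (q, s) =
      P B r s * A.trace * (1 : Matrix m m ℂ) p q + Q B r s * A p q :=
    congr_fun₂ ((hΦ.leftSlice B r s).eq_trace_smul_one_add_smul hij A) p q
  rw [h, (hΦ.rightSlice _ _ _).eq_trace_smul_one_add_smul hkl B,
    (hΦ.rightSlice _ _ _).eq_trace_smul_one_add_smul hkl B, ← one_kronecker_one]
  simp only [add_apply, smul_apply, smul_eq_mul, kroneckerMap_apply]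
  ring

end Matrix

/-- Every `ℂ`-linear map `Φ` on `M_{n₁}(ℂ) ⊗ M_{n₂}(ℂ)`
(matrices indexed by `Fin n₁ × Fin n₂`) that is `U(n₁)×U(n₂)`-equivariant — i.e.
`Φ((U⊗V)X(U⊗V)ᴴ) = (U⊗V)Φ(X)(U⊗V)ᴴ` for all unitaries `U, V` — acts on elementary
tensors as
`Φ(A⊗B) = λ₀₀·(trA·trB/(n₁n₂))·I + λ₀₁·(trA/n₁)·(I⊗B⊥) + λ₁₀·(trB/n₂)·(A⊥⊗I) + λ₁₁·(A⊥⊗B⊥)`,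
where `A⊥ = A − (trA/n₁)·I` and `B⊥ = B − (trB/n₂)·I`. -/
theorem product_unitary_equivariant_structure (n₁ n₂ : ℕ) (h1 : 2 ≤ n₁) (h2 : 2 ≤ n₂)
    (Φ : Matrix (Fin n₁ × Fin n₂) (Fin n₁ × Fin n₂) ℂ →ₗ[ℂ]
         Matrix (Fin n₁ × Fin n₂) (Fin n₁ × Fin n₂) ℂ)
    (hequiv : ∀ U : Matrix (Fin n₁) (Fin n₁) ℂ, U ∈ Matrix.unitaryGroup (Fin n₁) ℂ →
      ∀ V : Matrix (Fin n₂) (Fin n₂) ℂ, V ∈ Matrix.unitaryGroup (Fin n₂) ℂ →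
      ∀ X : Matrix (Fin n₁ × Fin n₂) (Fin n₁ × Fin n₂) ℂ,
        Φ ((U ⊗ₖ V) * X * (U ⊗ₖ V)ᴴ) = (U ⊗ₖ V) * Φ X * (U ⊗ₖ V)ᴴ) :
    ∃ l₀₀ l₀₁ l₁₀ l₁₁ : ℂ,
      ∀ (A : Matrix (Fin n₁) (Fin n₁) ℂ) (B : Matrix (Fin n₂) (Fin n₂) ℂ),
        Φ (A ⊗ₖ B) =
          (l₀₀ * (A.trace * B.trace / ((n₁ : ℂ) * (n₂ : ℂ)))) •
              (1 : Matrix (Fin n₁ × Fin n₂) (Fin n₁ × Fin n₂) ℂ)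
          + (l₀₁ * (A.trace / (n₁ : ℂ))) •
              ((1 : Matrix (Fin n₁) (Fin n₁) ℂ) ⊗ₖ (B - (B.trace / (n₂ : ℂ)) • 1))
          + (l₁₀ * (B.trace / (n₂ : ℂ))) •
              ((A - (A.trace / (n₁ : ℂ)) • 1) ⊗ₖ (1 : Matrix (Fin n₂) (Fin n₂) ℂ))
          + l₁₁ • ((A - (A.trace / (n₁ : ℂ)) • 1) ⊗ₖ (B - (B.trace / (n₂ : ℂ)) • 1)) := by
  have : Nontrivial (Fin n₁) := Fin.nontrivial_iff_two_le.mpr h1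
  have : Nontrivial (Fin n₂) := Fin.nontrivial_iff_two_le.mpr h2
  obtain ⟨a, b, c, d, h⟩ := IsProductUnitaryEquivariant.exists_apply_kronecker (Φ := Φ) hequiv
  have hn₁ : (n₁ : ℂ) ≠ 0 := Nat.cast_ne_zero.mpr (by omega)
  have hn₂ : (n₂ : ℂ) ≠ 0 := Nat.cast_ne_zero.mpr (by omega)
  refine ⟨n₁ * n₂ * a + n₁ * b + n₂ * c + d, n₁ * b + d, n₂ * c + d, d, fun A B ↦ ?_⟩
  rw [h, ← one_kronecker_one]
  ext ⟨p, r⟩ ⟨q, s⟩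
  simp only [Matrix.add_apply, Matrix.sub_apply, Matrix.smul_apply, smul_eq_mul, kroneckerMap_apply]
  field_simp
  ring
end
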